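/- There exist constants C > 0 and c > 0 such that for every m ≥ 4, setting n = 2^m and k = ⌈C n² log n⌉, there exists a function f mapping k-tuples of binary strings to codewords of RM(m,1) with the following property: for every codeword x ∈ RM(m,1), the fraction of deletion-pattern tuples (ω¹, …, ω^k) ∈ ({0,1}^n)^k (each pattern equally likely, corresponding to i.i.d. deletion probability q = 1/2) for which f(T_x(ω¹), …, T_x(ω^k)) = x is at least 1 − n^{−c}. -/

import Mathlib

open Finset

/-- Number of deletions in a deletion pattern (number of `1`s in `ω`). -/
def wt {n : ℕ} (ω : Fin n → Bool) : ℕ := (univ.filter fun j => ω j = true).card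

/-- Trace of `x` under deletion pattern `ω`: the subsequence of bits `x j`
at the positions `j` with `ω j = 0`, in increasing order of position. -/
def trc {n : ℕ} (x ω : Fin n → Bool) : List Bool :=
  ((List.finRange n).filter fun j => ω j = false).map x

/-- Total number of runs (maximal blocks of equal bits) in a binary list. -/
def numRuns (l : List Bool) : ℕ := (l.destutter (· ≠ ·)).length

/-- Number of runs of `0`s in a binary list. -/
def numZeroRuns (l : List Bool) : ℕ := (l.destutter (· ≠ ·)).count false

/-- Number of runs of `1`s in a binary list. -/
def numOneRuns (l : List Bool) : ℕ := (l.destutter (· ≠ ·)).count true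

/-- The first-order Reed-Muller code `RM(m,1)`: evaluation vectors of affine
Boolean polynomials `u₀ + u₁x₁ + ⋯ + u_mx_m`, coordinates indexed by the
`2^m` evaluation points in lexicographic order. -/
def RM1 (m : ℕ) : Set (Fin (2 ^ m) → Bool) :=
  { x | ∃ (u0 : Bool) (u : Fin m → Bool), ∀ t : Fin (2 ^ m),
      x t = (u0 ^^ decide ((univ.filter fun i : Fin m =>
        u i = true ∧ (t : ℕ).testBit (i : ℕ) = true).card % 2 = 1)) }

/-- The sign `(-1)^b` of a bit. -/
noncomputable def bsgn (b : Bool) : ℝ := if b then -1 else 1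

/-- The sign of the first bit of a list, `0` for the empty list. -/
noncomputable def headSign : List Bool → ℝ
  | [] => 0
  | a :: _ => bsgn a

/-- The sign of the last bit of a list, `0` for the empty list. -/
noncomputable def lastSign (l : List Bool) : ℝ := headSign l.reverse

/-- The sum of the products of the signs of adjacent bits. -/
noncomputable def adjSum : List Bool → ℝ
  | [] => 0
  | a :: l => bsgn a * headSign l + adjSum l

/-- The mean of `T` over the `2^|l|` subsequences of `l`. -/
noncomputable def subseqMean : (List Bool → ℝ) → List Bool → ℝ
  | T, [] => T []
  | T, a :: l => (subseqMean (fun y => T (a :: y)) l + subseqMean T l) / 2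

lemma bsgn_xor (a b : Bool) : bsgn (a ^^ b) = bsgn a * bsgn b := by
  cases a <;> cases b <;> simp [bsgn]

lemma bsgn_mul_self (a : Bool) : bsgn a * bsgn a = 1 := by
  cases a <;> simp [bsgn]

lemma abs_bsgn (a : Bool) : |bsgn a| = 1 := by
  cases a <;> simp [bsgn]

lemma abs_headSign_le (l : List Bool) : |headSign l| ≤ 1 := by
  cases l <;> simp [headSign, abs_bsgn]

lemma abs_adjSum_le (l : List Bool) : |adjSum l| ≤ l.length := by
  induction l with
  | nil => simp [adjSum]
  | cons a l ih =>
    have h : |bsgn a * headSign l| ≤ 1 := by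
      rw [abs_mul, abs_bsgn, one_mul]; exact abs_headSign_le l
    simp only [adjSum, List.length_cons]
    push_cast
    linarith [abs_add_le (bsgn a * headSign l) (adjSum l)]

lemma headSign_append (a b : List Bool) :
    headSign (a ++ b) = headSign a + (if a = [] then 1 else 0) * headSign b := by
  cases a <;> simp [headSign]

lemma lastSign_append (a b : List Bool) :
    lastSign (a ++ b) = lastSign b + (if b = [] then 1 else 0) * lastSign a := by
  simp [lastSign, headSign_append]

lemma adjSum_append (a b : List Bool) :
    adjSum (a ++ b) = adjSum a + adjSum b + lastSign a * headSign b := by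
  induction a with
  | nil => simp [adjSum, lastSign, headSign]
  | cons c a ih =>
    have h : lastSign (c :: a) = lastSign a + (if a = [] then 1 else 0) * bsgn c := by
      rw [lastSign, List.reverse_cons, headSign_append]
      simp [lastSign, headSign]
    simp only [List.cons_append, adjSum, ih, headSign_append, h]
    ring

lemma headSign_map_xor (c : Bool) (l : List Bool) :
    headSign (l.map (c ^^ ·)) = bsgn c * headSign l := by
  cases l <;> simp [headSign, bsgn_xor]

lemma lastSign_map_xor (c : Bool) (l : List Bool) :
    lastSign (l.map (c ^^ ·)) = bsgn c * lastSign l := by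
  simp only [lastSign, ← List.map_reverse, headSign_map_xor]

lemma adjSum_map_xor (c : Bool) (l : List Bool) :
    adjSum (l.map (c ^^ ·)) = adjSum l := by
  induction l with
  | nil => rfl
  | cons a l ih =>
    simp only [List.map_cons, adjSum, headSign_map_xor, ih, bsgn_xor]
    linear_combination (bsgn a * headSign l) * bsgn_mul_self c

lemma subseqMean_add (S T : List Bool → ℝ) (l : List Bool) :
    subseqMean (fun y => S y + T y) l = subseqMean S l + subseqMean T l := by
  induction l generalizing S T with
  | nil => rfl
  | cons a l ih => simp only [subseqMean, ih]; ring

lemma subseqMean_const_mul (c : ℝ) (T : List Bool → ℝ) (l : List Bool) :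
    subseqMean (fun y => c * T y) l = c * subseqMean T l := by
  induction l generalizing T with
  | nil => rfl
  | cons a l ih => simp only [subseqMean, ih]; ring

lemma subseqMean_mul_const (c : ℝ) (T : List Bool → ℝ) (l : List Bool) :
    subseqMean (fun y => T y * c) l = subseqMean T l * c := by
  simp only [mul_comm _ c, subseqMean_const_mul]

lemma subseqMean_const (c : ℝ) (l : List Bool) : subseqMean (fun _ => c) l = c := by
  induction l with
  | nil => rfl
  | cons a l ih => simp only [subseqMean, ih]; ring

lemma subseqMean_append (T : List Bool → ℝ) (l l' : List Bool) :
    subseqMean T (l ++ l') = subseqMean (fun a => subseqMean (fun b => T (a ++ b)) l') l := by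
  induction l generalizing T with
  | nil => rfl
  | cons a l ih => simp only [List.cons_append, subseqMean, ih]

lemma subseqMean_map (g : Bool → Bool) (T : List Bool → ℝ) (l : List Bool) :
    subseqMean T (l.map g) = subseqMean (fun y => T (y.map g)) l := by
  induction l generalizing T with
  | nil => rfl
  | cons a l ih => simp only [List.map_cons, subseqMean, ih]

lemma subseqMean_eq_nil (l : List Bool) :
    subseqMean (fun y => if y = [] then 1 else 0) l = (1 / 2 : ℝ) ^ l.length := by
  induction l with
  | nil => simp [subseqMean]
  | cons a l ih =>
    simp only [subseqMean, ih, List.length_cons, reduceCtorEq, if_false, subseqMean_const]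
    ring

lemma subseqMean_headSign_append (l l' : List Bool) :
    subseqMean headSign (l ++ l') =
      subseqMean headSign l + (1 / 2) ^ l.length * subseqMean headSign l' := by
  simp only [subseqMean_append, headSign_append, subseqMean_add, subseqMean_const,
    subseqMean_const_mul, subseqMean_mul_const, subseqMean_eq_nil]

lemma subseqMean_lastSign_append (l l' : List Bool) :
    subseqMean lastSign (l ++ l') =
      subseqMean lastSign l' + (1 / 2) ^ l'.length * subseqMean lastSign l := by
  simp only [subseqMean_append, lastSign_append, subseqMean_add, subseqMean_const,
    subseqMean_const_mul, subseqMean_mul_const, subseqMean_eq_nil]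

lemma subseqMean_adjSum_append (l l' : List Bool) :
    subseqMean adjSum (l ++ l') =
      subseqMean adjSum l + subseqMean adjSum l' +
        subseqMean lastSign l * subseqMean headSign l' := by
  simp only [subseqMean_append, adjSum_append, subseqMean_add, subseqMean_const,
    subseqMean_const_mul, subseqMean_mul_const]

lemma trc_cons {n : ℕ} (x ω : Fin (n + 1) → Bool) :
    trc x ω = if ω 0 then trc (Fin.tail x) (Fin.tail ω)
      else x 0 :: trc (Fin.tail x) (Fin.tail ω) := by
  unfold trc
  rw [List.finRange_succ, List.filter_cons]
  cases h : ω 0 <;> simp [List.filter_map, Function.comp_def, Fin.tail_def] <;> congr 2 <;>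
    ext j <;> rcases Bool.eq_false_or_eq_true (ω j.succ) with hj | hj <;> simp [hj]

lemma sum_trc {n : ℕ} (x : Fin n → Bool) (T : List Bool → ℝ) :
    ∑ ω : Fin n → Bool, T (trc x ω) = 2 ^ n * subseqMean T (List.ofFn x) := by
  induction n generalizing T with
  | zero => simp [trc, subseqMean]
  | succ n ih =>
    rw [← (Fin.consEquiv fun _ => Bool).sum_comp, Fintype.sum_prod_type]
    simp only [Fintype.sum_bool, trc_cons, Fin.consEquiv, Equiv.coe_fn_mk, Fin.cons_zero,
      Fin.tail_cons, if_true, Bool.false_eq_true, if_false]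
    rw [ih _ T, ih _ (fun y => T (x 0 :: y)), List.ofFn_succ, subseqMean, pow_succ]
    simp only [Fin.tail_def]
    ring

lemma length_trc_le {n : ℕ} (x ω : Fin n → Bool) : (trc x ω).length ≤ n := by
  unfold trc
  rw [List.length_map]
  simpa using List.length_filter_le (fun j => decide (ω j = false)) (List.finRange n)

/-- The parity of the linear form with coefficients `e 0, …, e (m - 1)` at the point `t`. -/
def linParity (e : ℕ → Bool) (m t : ℕ) : Bool :=
  decide (((range m).filter fun i => e i = true ∧ t.testBit i = true).card % 2 = 1)

lemma linParity_succ (e : ℕ → Bool) (m t : ℕ) :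
    linParity e (m + 1) t = ((e m && t.testBit m) ^^ linParity e m t) := by
  unfold linParity
  rw [range_add_one, filter_insert]
  by_cases h : e m = true ∧ t.testBit m = true
  · rw [if_pos h, card_insert_of_notMem (by simp), h.1, h.2]
    generalize card _ = c
    rcases Nat.mod_two_eq_zero_or_one c with hc | hc <;> simp [Nat.add_mod, hc]
  · rw [if_neg h]
    have : (e m && t.testBit m) = false := by simpa using h
    simp [this]

lemma linParity_two_pow_add (e : ℕ → Bool) (m t : ℕ) :
    linParity e m (2 ^ m + t) = linParity e m t := by
  unfold linParity
  congr 4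
  apply filter_congr
  intro i hi
  rw [Nat.testBit_two_pow_add_gt (mem_range.1 hi)]

/-- The list of values of the affine polynomial with constant term `u` and linear
coefficients `e 0, …, e (m - 1)`. -/
def affineWord (u : Bool) (e : ℕ → Bool) (m : ℕ) : List Bool :=
  (List.range (2 ^ m)).map fun t => u ^^ linParity e m t

lemma length_affineWord (u : Bool) (e : ℕ → Bool) (m : ℕ) :
    (affineWord u e m).length = 2 ^ m := by
  simp [affineWord]

lemma affineWord_zero (u : Bool) (e : ℕ → Bool) : affineWord u e 0 = [u] := by
  simp [affineWord, linParity]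

lemma affineWord_succ (u : Bool) (e : ℕ → Bool) (m : ℕ) :
    affineWord u e (m + 1) = affineWord u e m ++ (affineWord u e m).map (e m ^^ ·) := by
  unfold affineWord
  rw [pow_succ, mul_two, List.range_add, List.map_append, List.map_map, List.map_map]
  congr 1
  · apply List.map_congr_left
    intro t ht
    rw [linParity_succ, Nat.testBit_lt_two_pow (List.mem_range.1 ht)]
    simp
  · apply List.map_congr_left
    intro t ht
    simp only [Function.comp_apply]
    rw [linParity_succ, Nat.testBit_two_pow_add_eq,
      Nat.testBit_lt_two_pow (List.mem_range.1 ht), linParity_two_pow_add]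
    cases u <;> cases e m <;> simp

lemma exists_ofFn_eq_affineWord {m : ℕ} {x : Fin (2 ^ m) → Bool} (hx : x ∈ RM1 m) :
    ∃ u e, List.ofFn x = affineWord u e m := by
  obtain ⟨u, v, h⟩ := hx
  refine ⟨u, fun i => if hi : i < m then v ⟨i, hi⟩ else false, ?_⟩
  apply List.ext_getElem
  · simp [affineWord]
  · intro t h1 h2
    simp only [List.getElem_ofFn, affineWord, List.getElem_map, List.getElem_range, h, linParity]
    congr 4
    rw [← card_map Fin.valEmbedding]
    congr 1
    ext i
    simp only [mem_map, mem_filter, mem_univ, true_and, Fin.valEmbedding_apply, mem_range]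
    constructor
    · rintro ⟨j, hj, rfl⟩
      simpa using hj
    · rintro ⟨hi, hj⟩
      refine ⟨⟨i, hi⟩, ?_, rfl⟩
      simpa [hi] using hj

/-- The number of sign changes in the affine word with linear coefficients `e 0, …, e (m - 1)`. -/
def changeRank (e : ℕ → Bool) : ℕ → ℕ
  | 0 => 0
  | m + 1 => 2 * changeRank e m + (changeRank e m + (e m).toNat) % 2

/-- The absolute value of the doubled mean of the sign of the first bit of a trace. -/
noncomputable def headWeight : ℕ → ℕ → ℝ
  | 0, _ => 1
  | m + 1, r => headWeight m (r / 2) * (1 + (-1) ^ (r + r / 2) * (1 / 2) ^ 2 ^ m)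

/-- The mean of `adjSum` over the traces of the affine words with a given `changeRank`. -/
noncomputable def adjMean : ℕ → ℕ → ℝ
  | 0, _ => 0
  | m + 1, r => 2 * adjMean m (r / 2) + (-1) ^ r * headWeight m (r / 2) ^ 2 / 4

lemma changeRank_lt (e : ℕ → Bool) (m : ℕ) : changeRank e m < 2 ^ m := by
  induction m with
  | zero => simp [changeRank]
  | succ m ih => rw [changeRank, pow_succ]; omega

lemma changeRank_succ_div (e : ℕ → Bool) (m : ℕ) :
    changeRank e (m + 1) / 2 = changeRank e m := by
  rw [changeRank]; omega

lemma neg_one_pow_changeRank_succ (e : ℕ → Bool) (m : ℕ) :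
    (-1 : ℝ) ^ changeRank e (m + 1) = bsgn (e m) * (-1) ^ changeRank e m := by
  rw [changeRank, neg_one_pow_eq_pow_mod_two, neg_one_pow_eq_pow_mod_two (changeRank e m)]
  rcases Nat.mod_two_eq_zero_or_one (changeRank e m) with h | h <;>
    cases e m <;> simp [bsgn, Nat.add_mod, h]

lemma linear_eq_of_changeRank_eq {e e' : ℕ → Bool} {m : ℕ}
    (h : changeRank e m = changeRank e' m) : ∀ b < m, e b = e' b := by
  induction m with
  | zero => simp
  | succ m ih =>
    have h0 : changeRank e m = changeRank e' m := by
      rw [← changeRank_succ_div, h, changeRank_succ_div]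
    intro b hb
    rcases Nat.lt_succ_iff_lt_or_eq.1 hb with hb | rfl
    · exact ih h0 b hb
    · rw [changeRank, changeRank, h0] at h
      cases h1 : e b <;> cases h2 : e' b <;> simp [h1, h2] at h ⊢ <;> omega

lemma affineWord_congr {e e' : ℕ → Bool} {m : ℕ} (u : Bool) (h : ∀ b < m, e b = e' b) :
    affineWord u e m = affineWord u e' m := by
  unfold affineWord linParity
  apply List.map_congr_left
  intro t _
  congr 5
  apply filter_congr
  intro i hi
  rw [h i (mem_range.1 hi)]

lemma headWeight_changeRank_succ (e : ℕ → Bool) (m : ℕ) :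
    headWeight (m + 1) (changeRank e (m + 1)) =
      headWeight m (changeRank e m) * (1 + bsgn (e m) * (1 / 2) ^ 2 ^ m) := by
  have h : ((-1 : ℝ) ^ changeRank e m) * (-1) ^ changeRank e m = 1 := by
    rw [← mul_pow]; simp
  rw [headWeight, changeRank_succ_div, pow_add, neg_one_pow_changeRank_succ, mul_assoc (bsgn _),
    h, mul_one]

lemma subseqMean_headSign_affineWord (u : Bool) (e : ℕ → Bool) (m : ℕ) :
    subseqMean headSign (affineWord u e m) = bsgn u / 2 * headWeight m (changeRank e m) := by
  induction m with
  | zero => simp [affineWord_zero, subseqMean, headSign, headWeight]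
  | succ m ih =>
    rw [affineWord_succ, subseqMean_headSign_append, subseqMean_map]
    simp only [headSign_map_xor, subseqMean_const_mul]
    rw [ih, headWeight_changeRank_succ, length_affineWord]
    ring

lemma subseqMean_lastSign_affineWord (u : Bool) (e : ℕ → Bool) (m : ℕ) :
    subseqMean lastSign (affineWord u e m) =
      bsgn u / 2 * (-1) ^ changeRank e m * headWeight m (changeRank e m) := by
  induction m with
  | zero => simp [affineWord_zero, subseqMean, lastSign, headSign, headWeight, changeRank]
  | succ m ih =>
    rw [affineWord_succ, subseqMean_lastSign_append, subseqMean_map]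
    simp only [lastSign_map_xor, subseqMean_const_mul]
    rw [ih, headWeight_changeRank_succ, neg_one_pow_changeRank_succ, List.length_map,
      length_affineWord]
    linear_combination (-(bsgn u / 2 * (-1) ^ changeRank e m * headWeight m (changeRank e m) *
      (1 / 2) ^ 2 ^ m)) * bsgn_mul_self (e m)

lemma subseqMean_adjSum_affineWord (u : Bool) (e : ℕ → Bool) (m : ℕ) :
    subseqMean adjSum (affineWord u e m) = adjMean m (changeRank e m) := by
  induction m with
  | zero => simp [affineWord_zero, subseqMean, adjSum, headSign, adjMean]
  | succ m ih =>
    rw [affineWord_succ, subseqMean_adjSum_append, subseqMean_map, subseqMean_map]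
    simp only [headSign_map_xor, adjSum_map_xor, subseqMean_const_mul]
    rw [ih, subseqMean_lastSign_affineWord, subseqMean_headSign_affineWord, adjMean,
      changeRank_succ_div, neg_one_pow_changeRank_succ]
    linear_combination ((-1) ^ changeRank e m * headWeight m (changeRank e m) ^ 2 *
      bsgn (e m) / 4) * bsgn_mul_self u

lemma half_pow_two_pow_succ (m : ℕ) : ((1 / 2 : ℝ) ^ 2 ^ (m + 1)) = ((1 / 2) ^ 2 ^ m) ^ 2 := by
  rw [pow_succ, pow_mul]

lemma half_pow_two_pow_le (m : ℕ) : (1 / 2 : ℝ) ^ 2 ^ m ≤ 1 / 2 :=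
  pow_le_of_le_one (by norm_num) (by norm_num) (by positivity)

lemma headWeight_bounds (m r : ℕ) :
    (1 + 2 * (1 / 2) ^ 2 ^ m) / 4 ≤ headWeight m r ∧
      headWeight m r ≤ 2 * (1 - (1 / 2) ^ 2 ^ m) := by
  induction m generalizing r with
  | zero => norm_num [headWeight]
  | succ m ih =>
    obtain ⟨h1, h2⟩ := ih (r / 2)
    rw [headWeight, half_pow_two_pow_succ]
    have hy0 : (0 : ℝ) < (1 / 2) ^ 2 ^ m := by positivity
    have hy1 := half_pow_two_pow_le m
    have hsmall : headWeight m (r / 2) = 1 ∧ (1 / 2 : ℝ) ^ 2 ^ m = 1 / 2 ∨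
        (1 / 2 : ℝ) ^ 2 ^ m ≤ 1 / 4 := by
      cases m with
      | zero => left; norm_num [headWeight]
      | succ m =>
        right
        rw [half_pow_two_pow_succ]
        have := half_pow_two_pow_le m
        have : (0 : ℝ) < (1 / 2) ^ 2 ^ m := by positivity
        nlinarith
    generalize (1 / 2 : ℝ) ^ 2 ^ m = y at *
    generalize headWeight m (r / 2) = v at *
    have hv : 0 < v := by linarith
    rcases neg_one_pow_eq_or ℝ (r + r / 2) with h | h <;> rw [h]
    · refine ⟨by nlinarith [mul_pos hv hy0], by nlinarith⟩
    · refine ⟨?_, by nlinarith [mul_pos hv hy0]⟩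
      rcases hsmall with ⟨rfl, rfl⟩ | hs
      · norm_num
      · nlinarith

lemma adjMean_sub_succ (m r : ℕ) (hr : r + 1 < 2 ^ m) :
    adjMean m r - adjMean m (r + 1) =
      (headWeight m r ^ 2 + headWeight m (r + 1) ^ 2) / 4 /
        (1 + (-1) ^ r * (1 / 2) ^ 2 ^ m) := by
  induction m generalizing r with
  | zero => simp at hr
  | succ m ih =>
    have hy0 : (0 : ℝ) < (1 / 2) ^ 2 ^ m := by positivity
    have hy1 := half_pow_two_pow_le m
    rw [half_pow_two_pow_succ]
    simp only [adjMean, headWeight]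
    rcases Nat.even_or_odd' r with ⟨q, rfl | rfl⟩
    · have e1 : 2 * q / 2 = q := by omega
      have e2 : (2 * q + 1) / 2 = q := by omega
      have e3 : (-1 : ℝ) ^ (2 * q) = 1 := by simp [pow_mul]
      rw [e1, e2]
      simp only [pow_add, e3, pow_one]
      generalize (1 / 2 : ℝ) ^ 2 ^ m = y at *
      have : 1 + 1 * y ^ 2 ≠ 0 := by positivity
      field_simp
      rcases neg_one_pow_eq_or ℝ q with h | h <;> rw [h] <;> ring
    · have e1 : (2 * q + 1) / 2 = q := by omega
      have e2 : (2 * q + 1 + 1) / 2 = q + 1 := by omega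
      have e3 : (-1 : ℝ) ^ (2 * q) = 1 := by simp [pow_mul]
      rw [pow_succ] at hr
      have ih := ih q (by omega)
      rw [e1, e2]
      simp only [pow_add, e3, pow_one]
      rw [sub_eq_iff_eq_add] at ih
      rw [ih]
      generalize (1 / 2 : ℝ) ^ 2 ^ m = y at *
      have h1 : 1 - y ≠ 0 := by linarith
      have h2 : 1 + y ≠ 0 := by linarith
      have h3 : 1 - y ^ 2 ≠ 0 := by nlinarith
      rcases neg_one_pow_eq_or ℝ q with h | h <;> rw [h] <;>
        simp only [one_mul, mul_one, neg_mul, mul_neg, neg_neg, ← sub_eq_add_neg] <;>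
        field_simp <;> ring

lemma adjMean_succ_le (m r : ℕ) (hr : r + 1 < 2 ^ m) :
    adjMean m (r + 1) + 1 / 64 ≤ adjMean m r := by
  have hy0 : (0 : ℝ) < (1 / 2) ^ 2 ^ m := by positivity
  have hy1 := half_pow_two_pow_le m
  have h := adjMean_sub_succ m r hr
  have h1 := (headWeight_bounds m r).1
  have h2 := (headWeight_bounds m (r + 1)).1
  have h3 : 1 / 64 ≤ (headWeight m r ^ 2 + headWeight m (r + 1) ^ 2) / 4 /
      (1 + (-1) ^ r * (1 / 2) ^ 2 ^ m) := by
    rcases neg_one_pow_eq_or ℝ r with h | h <;> rw [h] <;>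
      rw [le_div_iff₀ (by linarith)] <;> nlinarith
  linarith

lemma adjMean_lt_le (m r s : ℕ) (hrs : r < s) (hs : s < 2 ^ m) :
    adjMean m s + 1 / 64 ≤ adjMean m r := by
  induction s, hrs using Nat.le_induction with
  | base => exact adjMean_succ_le m r hs
  | succ s hrs ih => linarith [ih (by omega), adjMean_succ_le m s hs]

/-- The trace statistic whose mean identifies a codeword. -/
noncomputable def traceStat (y : List Bool) : ℝ := adjSum y + 1 / 256 * headSign y

lemma subseqMean_traceStat_affineWord (u : Bool) (e : ℕ → Bool) (m : ℕ) :
    subseqMean traceStat (affineWord u e m) =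
      adjMean m (changeRank e m) + bsgn u / 512 * headWeight m (changeRank e m) := by
  unfold traceStat
  rw [subseqMean_add, subseqMean_const_mul, subseqMean_headSign_affineWord,
    subseqMean_adjSum_affineWord]
  ring

lemma abs_bsgn_div_mul_headWeight_le (u : Bool) (m r : ℕ) :
    |bsgn u / 512 * headWeight m r| ≤ 1 / 256 := by
  have hy0 : (0 : ℝ) < (1 / 2) ^ 2 ^ m := by positivity
  obtain ⟨h1, h2⟩ := headWeight_bounds m r
  rw [abs_mul, abs_div, abs_bsgn, abs_of_pos (show (0 : ℝ) < 512 by norm_num),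
    abs_of_pos (by linarith : 0 < headWeight m r)]
  linarith

lemma subseqMean_traceStat_separated {m : ℕ} {x x' : Fin (2 ^ m) → Bool}
    (hx : x ∈ RM1 m) (hx' : x' ∈ RM1 m) (hne : x ≠ x') :
    1 / 1024 ≤ |subseqMean traceStat (List.ofFn x) - subseqMean traceStat (List.ofFn x')| := by
  obtain ⟨u, e, h⟩ := exists_ofFn_eq_affineWord hx
  obtain ⟨u', e', h'⟩ := exists_ofFn_eq_affineWord hx'
  have hw : affineWord u e m ≠ affineWord u' e' m := by
    rw [← h, ← h']
    exact fun hh => hne (List.ofFn_injective hh)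
  rw [h, h', subseqMean_traceStat_affineWord, subseqMean_traceStat_affineWord]
  have b1 := abs_le.1 (abs_bsgn_div_mul_headWeight_le u m (changeRank e m))
  have b2 := abs_le.1 (abs_bsgn_div_mul_headWeight_le u' m (changeRank e' m))
  rcases lt_trichotomy (changeRank e m) (changeRank e' m) with hlt | heq | hlt
  · have := adjMean_lt_le m _ _ hlt (changeRank_lt e' m)
    rw [le_abs]; left; linarith
  · rw [affineWord_congr u (linear_eq_of_changeRank_eq heq)] at hw
    have hu : u ≠ u' := fun hu => hw (by rw [hu])
    rw [heq]
    have hy0 : (0 : ℝ) < (1 / 2) ^ 2 ^ m := by positivity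
    have := (headWeight_bounds m (changeRank e' m)).1
    cases u <;> cases u' <;> simp [bsgn] at hu ⊢ <;> rw [le_abs]
    · left; linarith
    · right; linarith
  · have := adjMean_lt_le m _ _ hlt (changeRank_lt e m)
    rw [le_abs]; right; linarith

lemma abs_traceStat_le (y : List Bool) : |traceStat y| ≤ y.length + 1 := by
  have h1 := abs_le.1 (abs_adjSum_le y)
  have h2 := abs_le.1 (abs_headSign_le y)
  unfold traceStat
  rw [abs_le]
  constructor <;> linarith

/-- Chernoff bound for independent uniform samples of a bounded centred function, in counting
form. -/
lemma card_sum_ge_le {Ω : Type*} [Fintype Ω] (X : Ω → ℝ) (hX : ∀ ω, |X ω| ≤ 1)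
    (hmean : ∑ ω, X ω = 0) (k : ℕ) (t : ℝ) (ht0 : 0 ≤ t) (ht : t ≤ 2) :
    ((univ.filter fun ωs : Fin k → Ω => k * t ≤ ∑ i, X (ωs i)).card : ℝ) ≤
      (Fintype.card Ω : ℝ) ^ k * Real.exp (-(k * t ^ 2 / 4)) := by
  have hone : ∑ ω, Real.exp (t / 2 * X ω) ≤ Fintype.card Ω * Real.exp (t ^ 2 / 4) := by
    calc ∑ ω, Real.exp (t / 2 * X ω) ≤ ∑ ω, (1 + t / 2 * X ω + t ^ 2 / 4) := by
          apply sum_le_sum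
          intro ω _
          have hX' := abs_le.1 (hX ω)
          have h1 : |t / 2 * X ω| ≤ 1 := by
            rw [abs_mul, abs_of_nonneg (by linarith : 0 ≤ t / 2)]
            exact mul_le_one₀ (by linarith) (abs_nonneg _) (hX ω)
          have h2 := (abs_le.1 (Real.abs_exp_sub_one_sub_id_le h1)).2
          have h3 : X ω ^ 2 ≤ 1 := by nlinarith
          nlinarith [mul_le_mul_of_nonneg_left h3 (sq_nonneg t)]
      _ = Fintype.card Ω * (1 + t ^ 2 / 4) := by
          simp only [sum_add_distrib, ← mul_sum, hmean, sum_const, card_univ, nsmul_eq_mul]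
          ring
      _ ≤ _ := by
          gcongr
          linarith [Real.add_one_le_exp (t ^ 2 / 4)]
  have hprod : ∑ ωs : Fin k → Ω, Real.exp (t / 2 * ∑ i, X (ωs i)) =
      (∑ ω, Real.exp (t / 2 * X ω)) ^ k := by
    rw [Fintype.sum_pow]
    simp only [mul_sum, Real.exp_sum]
  have hmarkov : ((univ.filter fun ωs : Fin k → Ω => k * t ≤ ∑ i, X (ωs i)).card : ℝ) *
      Real.exp (k * t ^ 2 / 2) ≤ ∑ ωs : Fin k → Ω, Real.exp (t / 2 * ∑ i, X (ωs i)) := by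
    rw [← nsmul_eq_mul]
    refine (card_nsmul_le_sum _ (fun ωs => Real.exp (t / 2 * ∑ i, X (ωs i))) _ ?_).trans
      (sum_le_sum_of_subset_of_nonneg (filter_subset _ _) fun _ _ _ => (Real.exp_pos _).le)
    intro ωs h
    have h := (mem_filter.1 h).2
    apply Real.exp_le_exp.2
    nlinarith
  have hpow : (∑ ω, Real.exp (t / 2 * X ω)) ^ k ≤
      (Fintype.card Ω : ℝ) ^ k * Real.exp (k * t ^ 2 / 4) := by
    calc _ ≤ (Fintype.card Ω * Real.exp (t ^ 2 / 4)) ^ k :=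
          pow_le_pow_left₀ (sum_nonneg fun _ _ => (Real.exp_pos _).le) hone k
      _ = _ := by
          rw [mul_pow, ← Real.exp_nat_mul]; ring_nf
  rw [hprod] at hmarkov
  have h := hmarkov.trans hpow
  rw [← le_div_iff₀ (Real.exp_pos _), mul_div_assoc, ← Real.exp_sub] at h
  rwa [show (k : ℝ) * t ^ 2 / 4 - k * t ^ 2 / 2 = -(k * t ^ 2 / 4) by ring] at h

lemma card_abs_sum_ge_le {Ω : Type*} [Fintype Ω] (X : Ω → ℝ) (hX : ∀ ω, |X ω| ≤ 1)
    (hmean : ∑ ω, X ω = 0) (k : ℕ) (t : ℝ) (ht0 : 0 ≤ t) (ht : t ≤ 2) :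
    ((univ.filter fun ωs : Fin k → Ω => k * t ≤ |∑ i, X (ωs i)|).card : ℝ) ≤
      2 * ((Fintype.card Ω : ℝ) ^ k * Real.exp (-(k * t ^ 2 / 4))) := by
  classical
  have h1 := card_sum_ge_le X hX hmean k t ht0 ht
  have h2 := card_sum_ge_le (fun ω => -X ω) (by simpa using hX) (by simpa using hmean) k t ht0 ht
  simp only [sum_neg_distrib] at h2
  have h3 : (univ.filter fun ωs : Fin k → Ω => k * t ≤ |∑ i, X (ωs i)|).card ≤
      (univ.filter fun ωs : Fin k → Ω => k * t ≤ ∑ i, X (ωs i)).card +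
      (univ.filter fun ωs : Fin k → Ω => k * t ≤ -∑ i, X (ωs i)).card := by
    refine le_trans (card_le_card ?_) (card_union_le _ _)
    intro ωs h
    simpa [le_abs] using h
  have h3' := (Nat.cast_le (α := ℝ)).2 h3
  push_cast at h3'
  linarith

/-- The traces whose empirical mean of `traceStat` is far from the mean are rare. -/
lemma card_traceStat_deviation_le {n : ℕ} (hn : 0 < n) (x : Fin n → Bool) (k : ℕ) :
    ((univ.filter fun ωs : Fin k → Fin n → Bool => (k : ℝ) * (1 / 2048) ≤
      |∑ i, traceStat (trc x (ωs i)) - k * subseqMean traceStat (List.ofFn x)|).card : ℝ) ≤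
      2 * (((2 : ℝ) ^ n) ^ k * Real.exp (-(k * (1 / (8192 * n)) ^ 2 / 4))) := by
  have hn' : (1 : ℝ) ≤ n := by exact_mod_cast hn
  set μ := subseqMean traceStat (List.ofFn x)
  have hT (ω : Fin n → Bool) : |traceStat (trc x ω)| ≤ 2 * n := by
    have h1 := abs_traceStat_le (trc x ω)
    have h2 : ((trc x ω).length : ℝ) ≤ n := by exact_mod_cast length_trc_le x ω
    linarith
  have hcard : (Fintype.card (Fin n → Bool) : ℝ) = 2 ^ n := by simp
  have hsum : ∑ ω : Fin n → Bool, traceStat (trc x ω) = 2 ^ n * μ := sum_trc x traceStat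
  have hμle : |μ| ≤ 2 * n := by
    have h1 : |(2 : ℝ) ^ n * μ| ≤ 2 ^ n * (2 * n) := by
      rw [← hsum, ← hcard]
      refine (abs_sum_le_sum_abs _ _).trans ((sum_le_sum fun ω _ => hT ω).trans ?_)
      simp
    rw [abs_mul, abs_of_pos (by positivity : (0 : ℝ) < 2 ^ n)] at h1
    exact le_of_mul_le_mul_left h1 (by positivity)
  have key := card_abs_sum_ge_le (fun ω => (traceStat (trc x ω) - μ) / (4 * n)) (by
      intro ω
      rw [abs_div, abs_of_pos (by positivity : (0 : ℝ) < 4 * n), div_le_one (by positivity)]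
      have := abs_sub (traceStat (trc x ω)) μ
      linarith [hT ω]) (by
      rw [← sum_div, sum_sub_distrib, hsum]
      simp) k (1 / (8192 * n)) (by positivity) (by
      rw [div_le_iff₀ (by positivity)]
      linarith)
  rw [hcard] at key
  convert key using 4
  rw [← sum_div, sum_sub_distrib, abs_div, abs_of_pos (by positivity : (0 : ℝ) < 4 * n),
    le_div_iff₀ (by positivity)]
  simp only [sum_const, card_univ, Fintype.card_fin, nsmul_eq_mul]
  have : (k : ℝ) * (1 / (8192 * n)) * (4 * n) = k * (1 / 2048) := by
    field_simp; ring
  rw [this]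

lemma two_mul_exp_neg_le {n : ℕ} (hn : 2 ≤ n) {k : ℝ}
    (hk : 8 * 8192 ^ 2 * (n : ℝ) ^ 2 * Real.log n ≤ k) :
    2 * Real.exp (-(k * (1 / (8192 * n)) ^ 2 / 4)) ≤ (n : ℝ)⁻¹ := by
  have hn' : (2 : ℝ) ≤ n := by exact_mod_cast hn
  have hn0 : (0 : ℝ) < n := by linarith
  have h : 2 * Real.log n ≤ k * (1 / (8192 * n)) ^ 2 / 4 := by
    calc 2 * Real.log n
        = 8 * 8192 ^ 2 * (n : ℝ) ^ 2 * Real.log n * (1 / (8192 * n)) ^ 2 / 4 := by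
          field_simp; ring
      _ ≤ _ := by gcongr
  calc 2 * Real.exp (-(k * (1 / (8192 * n)) ^ 2 / 4))
      ≤ 2 * Real.exp (-Real.log n + -Real.log n) := by
        gcongr; linarith
    _ = 2 * (n : ℝ)⁻¹ * (n : ℝ)⁻¹ := by
        rw [Real.exp_add, Real.exp_neg, Real.exp_log hn0]; ring
    _ ≤ 1 * (n : ℝ)⁻¹ := by
        gcongr
        rw [← div_eq_mul_inv, div_le_one hn0]
        exact hn'
    _ = _ := one_mul _

/-- `RM(m,1)` codewords can be reconstructed, with probability `≥ 1 - n^{-c}`,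
from `k = ⌈C n² log n⌉` traces through the deletion channel with `q = 1/2`. -/
theorem RM1_trace_reconstruction :
    ∃ C > (0:ℝ), ∃ c > (0:ℝ), ∀ m : ℕ, 4 ≤ m →
      ∀ k : ℕ, k = ⌈C * ((2 ^ m : ℕ) : ℝ) ^ 2 * Real.log ((2 ^ m : ℕ) : ℝ)⌉₊ →
        ∃ f : (Fin k → List Bool) → (Fin (2 ^ m) → Bool),
          (∀ v, f v ∈ RM1 m) ∧
          ∀ x ∈ RM1 m,
            1 - ((2 ^ m : ℕ) : ℝ) ^ (-c) ≤
              ((univ.filter fun ωs : Fin k → Fin (2 ^ m) → Bool =>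
                  f (fun i => trc x (ωs i)) = x).card : ℝ)
                / ((2 ^ (2 ^ m) : ℝ)) ^ k := by
  classical
  refine ⟨8 * 8192 ^ 2, by norm_num, 1, one_pos, ?_⟩
  intro m hm k hk
  have hn2 : 2 ≤ 2 ^ m := by
    calc 2 = 2 ^ 1 := rfl
      _ ≤ 2 ^ m := Nat.pow_le_pow_right (by norm_num) (by omega)
  have hexp := two_mul_exp_neg_le hn2 (k := k) (by rw [hk]; exact Nat.le_ceil _)
  let near (v : Fin k → List Bool) (x : Fin (2 ^ m) → Bool) : Prop :=
    x ∈ RM1 m ∧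
      |∑ i, traceStat (v i) - k * subseqMean traceStat (List.ofFn x)| < (k : ℝ) * (1 / 2048)
  have unique (v : Fin k → List Bool) (x x' : Fin (2 ^ m) → Bool) (h : near v x)
      (h' : near v x') : x = x' := by
    by_contra hne
    have hsep := mul_le_mul_of_nonneg_left
      (subseqMean_traceStat_separated h.1 h'.1 hne) (Nat.cast_nonneg (α := ℝ) k)
    rw [← abs_of_nonneg (Nat.cast_nonneg (α := ℝ) k), ← abs_mul,
      abs_of_nonneg (Nat.cast_nonneg (α := ℝ) k), mul_sub] at hsep
    have h1 := abs_lt.1 h.2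
    have h2 := abs_lt.1 h'.2
    rcases le_abs.1 hsep with h3 | h3 <;> linarith
  have hzero : (fun _ => false) ∈ RM1 m := ⟨false, fun _ => false, by simp⟩
  refine ⟨fun v => if h : ∃ x, near v x then h.choose else fun _ => false, ?_, ?_⟩
  · intro v
    dsimp only
    split_ifs with h
    · exact h.choose_spec.1
    · exact hzero
  intro x hx
  have hbad := card_traceStat_deviation_le (by omega) x k
  rw [Real.rpow_neg_one, le_div_iff₀ (by positivity)]
  have hcompl := card_filter_add_card_filter_not (s := (univ : Finset (Fin k → Fin (2 ^ m) → Bool)))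
    (fun ωs => (k : ℝ) * (1 / 2048) ≤
      |∑ i, traceStat (trc x (ωs i)) - k * subseqMean traceStat (List.ofFn x)|)
  have hcompl' := congrArg (Nat.cast (R := ℝ)) hcompl
  simp only [card_univ, Fintype.card_fun, Fintype.card_bool, Fintype.card_fin] at hcompl'
  push_cast at hcompl'
  have hgood : ((univ.filter fun ωs : Fin k → Fin (2 ^ m) → Bool => ¬ (k : ℝ) * (1 / 2048) ≤
      |∑ i, traceStat (trc x (ωs i)) - k * subseqMean traceStat (List.ofFn x)|).card : ℝ) ≤
      (univ.filter fun ωs : Fin k → Fin (2 ^ m) → Bool =>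
        (if h : ∃ x', near (fun i => trc x (ωs i)) x' then h.choose else fun _ => false)
          = x).card := by
    norm_cast
    apply card_le_card
    intro ωs h
    simp only [mem_filter, mem_univ, true_and, not_le] at h ⊢
    have hne : ∃ x', near (fun i => trc x (ωs i)) x' := ⟨x, hx, h⟩
    rw [dif_pos hne]
    exact unique _ _ _ hne.choose_spec ⟨hx, h⟩
  have hpos : (0 : ℝ) < (2 ^ 2 ^ m) ^ k := by positivity
  have := mul_le_mul_of_nonneg_left hexp hpos.le
  refine le_trans ?_ hgood
  linarith
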